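/- For any pair of SQHT=_S interpretations I1 and I2: I1 = I2 if and only if C(I1) = C(I2), where C(·) is the coherent closure. -/

import Mathlib

open Classical

noncomputable section

/-! ## Worlds (here and there) -/

inductive W : Type
  | h
  | t

/-- The ordering `h ≤ t` on worlds. -/
def W.le : W → W → Prop
  | .h, _ => True
  | .t, .t => True
  | .t, .h => False

/-! ## Tuples: nonempty finite tuples, encoded as head + tail -/

abbrev Tup (α : Type u) : Type u := α × List α

/-- The tuple `(g 0, …, g n)` determined by a family on `Fin (n+1)`. -/
def famToTup {α : Type u} {n : ℕ} (g : Fin (n + 1) → α) : Tup α :=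
  (g 0, List.ofFn fun i : Fin n => g i.succ)

/-- Combine a finite family of optional values into an optional family:
`some` iff all components are defined. -/
def optFam {α : Type u} {m : ℕ} (f : Fin m → Option α) : Option (Fin m → α) :=
  if h : ∀ i, (f i).isSome then some fun i => (f i).get (h i) else none

/-! ## The domain `D`: atoms (Herbrand terms) plus, at each finite level,
all sets of (nonempty) tuples over the previous level.
We realise it as the quotient of a type of "pre-domain elements" of finite
rank by extensional equivalence. -/

/-- Pre-domain elements over a type `A` of atoms: an atom, or a set of
nonempty tuples (each tuple encoded as head + tail), indexed by an arbitrary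
(small) index type. -/
inductive PD (A : Type) : Type 1
  | atom : A → PD A
  | set : (ι : Type) → (ι → PD A) → (ι → List (PD A)) → PD A

/-- `x` has rank at most `n` (atoms have rank `0`). -/
def PD.rankLe {A : Type} : ℕ → PD A → Prop
  | 0, .atom _ => True
  | 0, .set _ _ _ => False
  | _ + 1, .atom _ => True
  | n + 1, .set _ hd tl => ∀ i, PD.rankLe n (hd i) ∧ ∀ z ∈ tl i, PD.rankLe n z

/-- Finite rank: the element appears at some finite level `D^i` of the
domain hierarchy. -/
def PD.FiniteRank {A : Type} (x : PD A) : Prop := ∃ n, PD.rankLe n x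

/-- Extensional equivalence up to depth `n`. -/
def PD.EquivLe {A : Type} : ℕ → PD A → PD A → Prop
  | 0, .atom a, .atom b => a = b
  | 0, _, _ => False
  | _ + 1, .atom a, .atom b => a = b
  | n + 1, .set _ hd tl, .set _ hd' tl' =>
      (∀ i, ∃ j, PD.EquivLe n (hd i) (hd' j) ∧ List.Forall₂ (PD.EquivLe n) (tl i) (tl' j)) ∧
      (∀ j, ∃ i, PD.EquivLe n (hd i) (hd' j) ∧ List.Forall₂ (PD.EquivLe n) (tl i) (tl' j))
  | _ + 1, _, _ => False

/-- Extensional equivalence (witnessed at some finite depth). -/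
def PD.Equiv {A : Type} (x y : PD A) : Prop := ∃ n, PD.EquivLe n x y

/-- The domain over atoms `A`: finite-rank pre-domain elements modulo
extensional equivalence. -/
def DD (A : Type) : Type 1 :=
  Quot fun x y : { z : PD A // z.FiniteRank } => PD.Equiv x.1 y.1

def toD {A : Type} (x : PD A) (h : x.FiniteRank) : DD A := Quot.mk _ ⟨x, h⟩

def atomD {A : Type} (a : A) : DD A := toD (PD.atom a) ⟨0, by simp [PD.rankLe]⟩

/-- `z` (a pre-domain element) represents the domain element `w`. -/
def repD {A : Type} (z : PD A) (w : DD A) : Prop := ∃ h, w = toD z h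

/-- Membership of a tuple in a domain element (meaningful when the latter
is a set). -/
def dmem {A : Type} (v : Tup (DD A)) (d : DD A) : Prop :=
  ∃ (ι : Type) (hd : ι → PD A) (tl : ι → List (PD A)) (hfr : (PD.set ι hd tl).FiniteRank),
    d = toD (PD.set ι hd tl) hfr ∧ ∃ i, repD (hd i) v.1 ∧ List.Forall₂ repD (tl i) v.2

/-- The domain elements that are sets (the subset `𝒮 = D ∖ D⁰`). -/
def IsSetD {A : Type} (d : DD A) : Prop :=
  ∃ (ι : Type) (hd : ι → PD A) (tl : ι → List (PD A)) (hfr : (PD.set ι hd tl).FiniteRank),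
    d = toD (PD.set ι hd tl) hfr

/-- The domain element whose members are exactly the tuples in `s`
(`none` if there is no such element of the domain). -/
def mkSet? {A : Type} (s : Set (Tup (DD A))) : Option (DD A) :=
  if h : ∃ d : DD A, IsSetD d ∧ ∀ v, dmem v d ↔ v ∈ s then some h.choose else none


universe v

/-! ## Signatures -/

/-- A signature: Herbrand function (constructor) names `C`, evaluable
function names `F`, and predicate names `P`, each with an arity, with at
least one Herbrand constant. -/
structure Sig : Type (v + 1) where
  C : Type
  arC : C → ℕ
  F : Type v
  arF : F → ℕ
  P : Type
  arP : P → ℕ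
  hasConst : ∃ c, arC c = 0

/-- Ground Herbrand terms over constructors `C`. -/
inductive HTerm (C : Type) (ar : C → ℕ) : Type
  | mk : (c : C) → (Fin (ar c) → HTerm C ar) → HTerm C ar

/-- The domain `D` of a signature: the Herbrand universe `Terms_F(C)`
together with all (finite-level) sets of nonempty tuples over it. -/
abbrev D (S : Sig.{v}) : Type 1 := DD (HTerm S.C S.arC)

/-! ## Terms and formulas (with extensional and intensional sets).
Quantified variables and the variables bound by an intensional set are
handled by substitution of arbitrary domain elements (which are available
as constant terms via `GTerm.dom`), so terms and formulas below are the
*ground* terms and *sentences* of the language. -/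

mutual
  inductive GTerm (S : Sig.{v}) : Type (max 1 v)
    /-- every element of the domain is a (ground) term -/
    | dom : D S → GTerm S
    /-- Herbrand (constructor) function application -/
    | ctor : (c : S.C) → (Fin (S.arC c) → GTerm S) → GTerm S
    /-- evaluable function application -/
    | func : (f : S.F) → (Fin (S.arF f) → GTerm S) → GTerm S
    /-- extensional set `{τ⃗₁, …, τ⃗_m}` of `m` tuples of terms, each of
    arity `n+1` -/
    | eset : (m n : ℕ) → (Fin m → Fin (n + 1) → GTerm S) → GTerm S
    /-- intensional set `{x⃗ : τ⃗(x⃗) : φ(x⃗)}` with `k` bound variables and a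
    tuple of `n+1` terms -/
    | iset : (k n : ℕ) → ((Fin k → D S) → Fin (n + 1) → GTerm S) →
        ((Fin k → D S) → Formula S) → GTerm S

  inductive Formula (S : Sig.{v}) : Type (max 1 v)
    | falsum : Formula S
    | verum : Formula S
    | atom : (p : S.P) → (Fin (S.arP p) → GTerm S) → Formula S
    | eq : GTerm S → GTerm S → Formula S
    | and : Formula S → Formula S → Formula S
    | or : Formula S → Formula S → Formula S
    | imp : Formula S → Formula S → Formula S
    | all : (D S → Formula S) → Formula S
    | ex : (D S → Formula S) → Formula S
end

/-- `¬φ` is an abbreviation for `φ → ⊥`. -/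
def Formula.neg {S : Sig.{v}} (φ : Formula S) : Formula S := .imp φ .falsum

/-- Ground atoms over the domain: the Herbrand base. -/
def GAtom (S : Sig.{v}) : Type 1 := Σ p : S.P, Fin (S.arP p) → D S

/-! ## Assignments and interpretations -/

/-- An assignment maps every ground term to a domain element or `none`
(undefined, `u`). -/
abbrev Assign (S : Sig.{v}) := GTerm S → Option (D S)

/-- The conditions an assignment must satisfy: identity on domain
constants, strictness and substitutivity for function application, the
Herbrand interpretation of constructors on atoms, and evaluation of
extensional set terms. -/
def AssignValid {S : Sig.{v}} (σ : Assign S) : Prop :=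
  (∀ d, σ (.dom d) = some d) ∧
  (∀ c args, (∃ i, σ (args i) = none) → σ (.ctor c args) = none) ∧
  (∀ c args (ds : Fin (S.arC c) → D S), (∀ i, σ (args i) = some (ds i)) →
      σ (.ctor c args) = σ (.ctor c fun i => .dom (ds i))) ∧
  (∀ c (hs : Fin (S.arC c) → HTerm S.C S.arC),
      σ (.ctor c fun i => .dom (atomD (hs i))) = some (atomD (HTerm.mk c hs))) ∧
  (∀ f args, (∃ i, σ (args i) = none) → σ (.func f args) = none) ∧
  (∀ f args (ds : Fin (S.arF f) → D S), (∀ i, σ (args i) = some (ds i)) →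
      σ (.func f args) = σ (.func f fun i => .dom (ds i))) ∧
  (∀ m n tups, (∃ j i, σ (tups j i) = none) → σ (.eset m n tups) = none) ∧
  (∀ m n tups (ds : Fin m → Fin (n + 1) → D S), (∀ j i, σ (tups j i) = some (ds j i)) →
      σ (.eset m n tups) = mkSet? { v | ∃ j, v = famToTup (ds j) })

/-- `σ ≼ σ'` : on every ground term, `σ` agrees with `σ'` or is undefined. -/
def AssignLe {S : Sig.{v}} (σ σ' : Assign S) : Prop :=
  ∀ τ, σ τ = σ' τ ∨ σ τ = none

/-- An interpretation `⟨σʰ, σᵗ, Iʰ, Iᵗ⟩`. -/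
structure Interp (S : Sig.{v}) : Type (max 1 v) where
  sh : Assign S
  st : Assign S
  Ih : Set (GAtom S)
  It : Set (GAtom S)

/-- The assignment of `I` at world `w`. -/
def Interp.s {S : Sig.{v}} (I : Interp S) : W → Assign S
  | .h => I.sh
  | .t => I.st

/-- The atoms of `I` at world `w`. -/
def Interp.atoms {S : Sig.{v}} (I : Interp S) : W → Set (GAtom S)
  | .h => I.Ih
  | .t => I.It

/-- The defining conditions of an interpretation: both assignments are
proper assignments, `σʰ ≼ σᵗ` and `Iʰ ⊆ Iᵗ`. -/
def Interp.Valid {S : Sig.{v}} (I : Interp S) : Prop :=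
  AssignValid I.sh ∧ AssignValid I.st ∧ AssignLe I.sh I.st ∧ I.Ih ⊆ I.It

/-! ## 𝒮-satisfaction -/

/-- `SatS I w φ` : `I, w ⊨_𝒮 φ`. -/
def SatS {S : Sig.{v}} (I : Interp S) : W → Formula S → Prop
  | _, .falsum => False
  | _, .verum => True
  | w, .atom p args => ∃ ds : Fin (S.arP p) → D S,
      (∀ i, I.s w (args i) = some (ds i)) ∧ (⟨p, ds⟩ : GAtom S) ∈ I.atoms w
  | w, .eq t1 t2 => ∃ d, I.s w t1 = some d ∧ I.s w t2 = some d
  | w, .and a b => SatS I w a ∧ SatS I w b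
  | w, .or a b => SatS I w a ∨ SatS I w b
  | w, .imp a b => ∀ w', W.le w w' → (SatS I w' a → SatS I w' b)
  | w, .all b => ∀ d, SatS I w (b d)
  | w, .ex b => ∃ d, SatS I w (b d)

/-! ## Extension of intensional sets and the coherent closure -/

/-- The extension `ext(I, w, {x⃗ : τ⃗(x⃗) : φ(x⃗)})`: the set of values of the
tuples `τ⃗(c⃗)` for those `c⃗ ∈ D^k` with `I, w ⊨_𝒮 φ(c⃗)`; it is undefined if
one of these values is undefined (or if the resulting collection is not a
member of the domain). -/
def extw {S : Sig.{v}} (I : Interp S) (w : W) (k n : ℕ)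
    (tv : (Fin k → D S) → Fin (n + 1) → GTerm S)
    (φ : (Fin k → D S) → Formula S) : Option (D S) :=
  if ∃ c : Fin k → D S, SatS I w (φ c) ∧ ∃ i, I.s w (tv c i) = none then none
  else
    mkSet? { val | ∃ (c : Fin k → D S) (ds : Fin (n + 1) → D S),
      SatS I w (φ c) ∧ (∀ i, I.s w (tv c i) = some (ds i)) ∧ val = famToTup ds }

/-- The assignment `σ_I^w` of the coherent closure of `I`: it agrees with
`σ^w` on terms without intensional sets, it assigns to an intensional set
its extension at `t`, at `h` its extension when the two extensions agree
(and `u` otherwise), and is extended to all remaining terms by the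
assignment conditions. -/
def cval {S : Sig.{v}} (I : Interp S) (w : W) : GTerm S → Option (D S)
  | .dom d => some d
  | .ctor c args =>
      match optFam fun i => cval I w (args i) with
      | none => none
      | some ds => I.s w (.ctor c fun i => .dom (ds i))
  | .func f args =>
      match optFam fun i => cval I w (args i) with
      | none => none
      | some ds => I.s w (.func f fun i => .dom (ds i))
  | .eset _ _ tups =>
      match optFam fun j => optFam fun i => cval I w (tups j i) with
      | none => none
      | some g => mkSet? { val | ∃ j, val = famToTup (g j) }
  | .iset k n tv φ =>
      match w with
      | .t => extw I .t k n tv φ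
      | .h => if extw I .h k n tv φ = extw I .t k n tv φ then extw I .h k n tv φ else none

/-- The coherent closure `C(I)` of an interpretation. -/
def CohC {S : Sig.{v}} (I : Interp S) : Interp S :=
  ⟨cval I .h, cval I .t, I.Ih, I.It⟩

/-- `I` is coherent (w.r.t. intensional sets) iff `I = C(I)`. -/
def Interp.Coherent {S : Sig.{v}} (I : Interp S) : Prop := CohC I = I

/-! ## 0-formulas (no intensional sets) and `SQHT⁼_F` over `⟨C ∪ 𝒮, F, P⟩`.
A `0`-formula over `Σ = ⟨C, F, P⟩` is at the same time an `SQHT⁼_F` formula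
over the signature `⟨C ∪ 𝒮, F, P⟩`, whose Herbrand universe is the domain
`D`.  An `SQHT⁼_F` interpretation over `⟨C ∪ 𝒮, F, P⟩` is an interpretation
whose assignments are only defined on terms without intensional sets. -/

mutual
  def IsZeroT {S : Sig.{v}} : GTerm S → Prop
    | .dom _ => True
    | .ctor _ args => ∀ i, IsZeroT (args i)
    | .func _ args => ∀ i, IsZeroT (args i)
    | .eset _ _ tups => ∀ j i, IsZeroT (tups j i)
    | .iset _ _ _ _ => False

  def IsZeroF {S : Sig.{v}} : Formula S → Prop
    | .falsum => True
    | .verum => True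
    | .atom _ args => ∀ i, IsZeroT (args i)
    | .eq t1 t2 => IsZeroT t1 ∧ IsZeroT t2
    | .and a b => IsZeroF a ∧ IsZeroF b
    | .or a b => IsZeroF a ∧ IsZeroF b
    | .imp a b => IsZeroF a ∧ IsZeroF b
    | .all b => ∀ d, IsZeroF (b d)
    | .ex b => ∀ d, IsZeroF (b d)
end

/-- An `SQHT⁼_F` interpretation over `⟨C ∪ 𝒮, F, P⟩`: assignments are given
on the terms without intensional sets only. -/
structure FInterp (S : Sig.{v}) : Type (max 1 v) where
  sh : { τ : GTerm S // IsZeroT τ } → Option (D S)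
  st : { τ : GTerm S // IsZeroT τ } → Option (D S)
  Ih : Set (GAtom S)
  It : Set (GAtom S)

/-- The restriction `Î` of an `SQHT⁼_𝒮` interpretation to the terms without
intensional sets. -/
def Interp.hat {S : Sig.{v}} (I : Interp S) : FInterp S :=
  ⟨fun τ => I.sh τ.1, fun τ => I.st τ.1, I.Ih, I.It⟩

/-- The canonical extension of an `SQHT⁼_F` interpretation to all terms
(undefined outside terms without intensional sets); it is used to evaluate
`SQHT⁼_F` satisfaction, which only depends on the values on terms without
intensional sets. -/
def FInterp.toInterp {S : Sig.{v}} (J : FInterp S) : Interp S :=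
  ⟨fun τ => if h : IsZeroT τ then J.sh ⟨τ, h⟩ else none,
   fun τ => if h : IsZeroT τ then J.st ⟨τ, h⟩ else none, J.Ih, J.It⟩

/-- `SQHT⁼_F` satisfaction `I, w ⊨_F φ` (for `0`-formulas `φ`, i.e.
`SQHT⁼_F` formulas over `⟨C ∪ 𝒮, F, P⟩`): the same clauses as `⊨_𝒮`, with
quantifiers ranging over the Herbrand universe of `⟨C ∪ 𝒮, F, P⟩`. -/
def SatF {S : Sig.{v}} (J : FInterp S) (w : W) (φ : Formula S) : Prop :=
  SatS J.toInterp w φ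

/-- Validity of an `SQHT⁼_F` interpretation. -/
def FInterp.Valid {S : Sig.{v}} (J : FInterp S) : Prop := J.toInterp.Valid

/-! ## Orderings between interpretations, equilibrium and stable models -/

/-- `I₁ ≼ I₂` : same `there` component, smaller `here` component. -/
def ILe {S : Sig.{v}} (I1 I2 : Interp S) : Prop :=
  I1.It = I2.It ∧ I1.st = I2.st ∧ I1.Ih ⊆ I2.Ih ∧ AssignLe I1.sh I2.sh

/-- `I₁ ≺ I₂`. -/
def ILt {S : Sig.{v}} (I1 I2 : Interp S) : Prop := ILe I1 I2 ∧ I1 ≠ I2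

/-- The total interpretation `⟨σ, T⟩`. -/
def totalI {S : Sig.{v}} (σ : Assign S) (T : Set (GAtom S)) : Interp S := ⟨σ, σ, T, T⟩

/-- `I` is a model of the theory `Γ` : `I` is a (coherent) interpretation
and `I, h ⊨_𝒮 φ` for every `φ ∈ Γ`. -/
def ModelS {S : Sig.{v}} (I : Interp S) (Γ : Set (Formula S)) : Prop :=
  I.Valid ∧ I.Coherent ∧ ∀ φ ∈ Γ, SatS I .h φ

/-- `⟨σ, T⟩` is an equilibrium model of `Γ`. -/
def EqModelS {S : Sig.{v}} (Γ : Set (Formula S)) (σ : Assign S) (T : Set (GAtom S)) : Prop :=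
  ModelS (totalI σ T) Γ ∧ ∀ I', ILt I' (totalI σ T) → ¬ ModelS I' Γ

/-- `T` is a stable model of `Γ` (`SQHT⁼_𝒮` equilibrium semantics). -/
def StableS {S : Sig.{v}} (Γ : Set (Formula S)) (T : Set (GAtom S)) : Prop :=
  ∃ σ, EqModelS Γ σ T

/-- The ordering on `SQHT⁼_F` assignments. -/
def FAssignLe {S : Sig.{v}} (σ σ' : { τ : GTerm S // IsZeroT τ } → Option (D S)) : Prop :=
  ∀ τ, σ τ = σ' τ ∨ σ τ = none

/-- `≼` on `SQHT⁼_F` interpretations. -/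
def FILe {S : Sig.{v}} (J1 J2 : FInterp S) : Prop :=
  J1.It = J2.It ∧ J1.st = J2.st ∧ J1.Ih ⊆ J2.Ih ∧ FAssignLe J1.sh J2.sh

def FILt {S : Sig.{v}} (J1 J2 : FInterp S) : Prop := FILe J1 J2 ∧ J1 ≠ J2

def totalF {S : Sig.{v}} (σ : { τ : GTerm S // IsZeroT τ } → Option (D S))
    (T : Set (GAtom S)) : FInterp S := ⟨σ, σ, T, T⟩

/-- `J` is an `SQHT⁼_F` model of `Γ`. -/
def ModelF {S : Sig.{v}} (J : FInterp S) (Γ : Set (Formula S)) : Prop :=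
  J.Valid ∧ ∀ φ ∈ Γ, SatF J .h φ

/-- `T` is a stable model of `Γ` under the `SQHT⁼_F` equilibrium semantics
over the signature `⟨C ∪ 𝒮, F, P⟩`. -/
def StableF {S : Sig.{v}} (Γ : Set (Formula S)) (T : Set (GAtom S)) : Prop :=
  ∃ σ, ModelF (totalF σ T) Γ ∧ ∀ J', FILt J' (totalF σ T) → ¬ ModelF J' Γ

theorem forall₂_trans {α : Type*} {r : α → α → Prop} (hr : ∀ x y z, r x y → r y z → r x z)
    {l₁ l₂ l₃ : List α} (h : List.Forall₂ r l₁ l₂) (h' : List.Forall₂ r l₂ l₃) :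
    List.Forall₂ r l₁ l₃ := by
  induction h generalizing l₃ with
  | nil => exact h'
  | cons hd _ ih =>
    cases h' with
    | cons hd' tl' => exact .cons (hr _ _ _ hd hd') (ih tl')

namespace PD

variable {A : Type}

theorem EquivLe.succ {n : ℕ} {x y : PD A} (h : EquivLe n x y) : EquivLe (n + 1) x y := by
  induction n generalizing x y with
  | zero => cases x <;> cases y <;> simp_all [EquivLe]
  | succ n ih =>
    cases x <;> cases y <;> try exact h
    exact ⟨fun i => (h.1 i).imp fun _ hj => ⟨ih hj.1, hj.2.imp fun _ _ => ih⟩,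
      fun j => (h.2 j).imp fun _ hi => ⟨ih hi.1, hi.2.imp fun _ _ => ih⟩⟩

theorem EquivLe.mono {m n : ℕ} (hmn : m ≤ n) {x y : PD A} (h : EquivLe m x y) :
    EquivLe n x y := by
  induction hmn with
  | refl => exact h
  | step _ ih => exact ih.succ

theorem EquivLe.symm {n : ℕ} {x y : PD A} (h : EquivLe n x y) : EquivLe n y x := by
  induction n generalizing x y with
  | zero => cases x <;> cases y <;> simp_all [EquivLe]
  | succ n ih =>
    cases x <;> cases y
    · exact Eq.symm h
    · exact h
    · exact h
    · exact ⟨fun i => (h.2 i).imp fun _ hj => ⟨ih hj.1, (hj.2.imp fun _ _ => ih).flip⟩,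
        fun j => (h.1 j).imp fun _ hi => ⟨ih hi.1, (hi.2.imp fun _ _ => ih).flip⟩⟩

theorem EquivLe.trans {n : ℕ} {x y z : PD A} (h : EquivLe n x y) (h' : EquivLe n y z) :
    EquivLe n x z := by
  induction n generalizing x y z with
  | zero => cases x <;> cases y <;> cases z <;> simp_all [EquivLe]
  | succ n ih =>
    cases x <;> cases y <;> cases z <;> try exact h.elim
    · exact Eq.trans h h'
    · exact h'
    · exact h'.elim
    · refine ⟨fun i => ?_, fun k => ?_⟩
      · obtain ⟨j, hj, hj'⟩ := h.1 i
        obtain ⟨k, hk, hk'⟩ := h'.1 j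
        exact ⟨k, ih hj hk, forall₂_trans (r := EquivLe n) (fun _ _ _ => ih) hj' hk'⟩
      · obtain ⟨j, hj, hj'⟩ := h'.2 k
        obtain ⟨i, hi, hi'⟩ := h.2 j
        exact ⟨i, ih hi hj, forall₂_trans (r := EquivLe n) (fun _ _ _ => ih) hi' hj'⟩

theorem EquivLe.refl {n : ℕ} {x : PD A} (h : rankLe n x) : EquivLe n x x := by
  induction n generalizing x with
  | zero => cases x <;> simp_all [EquivLe, rankLe]
  | succ n ih =>
    cases x with
    | atom a => exact Eq.refl a
    | set ι hd tl =>
      have hi : ∀ i, ∃ j, EquivLe n (hd i) (hd j) ∧ List.Forall₂ (EquivLe n) (tl i) (tl j) :=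
        fun i => ⟨i, ih (h i).1, List.forall₂_same.2 fun z hz => ih ((h i).2 z hz)⟩
      exact ⟨hi, fun i => ⟨i, ih (h i).1, List.forall₂_same.2 fun z hz => ih ((h i).2 z hz)⟩⟩

theorem equiv_of_toD_eq {x y : PD A} {hx : x.FiniteRank} {hy : y.FiniteRank}
    (h : toD x hx = toD y hy) : x.Equiv y := by
  have key : ∀ a b : { z : PD A // z.FiniteRank },
      Relation.EqvGen (fun x y : { z : PD A // z.FiniteRank } => PD.Equiv x.1 y.1) a b →
        PD.Equiv a.1 b.1 := by
    intro a b hab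
    induction hab with
    | rel _ _ h => exact h
    | refl a => exact a.2.imp fun _ => EquivLe.refl
    | symm _ _ _ ih => exact ih.imp fun _ => EquivLe.symm
    | trans _ _ _ _ _ ih ih' =>
      obtain ⟨m, hm⟩ := ih
      obtain ⟨n, hn⟩ := ih'
      exact ⟨max m n, (hm.mono (le_max_left m n)).trans (hn.mono (le_max_right m n))⟩
  exact key _ _ (Quot.eqvGen_exact h)

end PD

/-- The set of one-element tuples with entry the value of `o`, if defined. -/
def optTuples {α : Type*} (o : Option α) : Set (Tup α) := { v | ∃ d, o = some d ∧ v = (d, []) }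

theorem optTuples_injective {α : Type*} :
    Function.Injective (optTuples : Option α → Set (Tup α)) := by
  intro o o' h
  refine Option.ext fun d => ?_
  have hd := Set.ext_iff.1 h (d, [])
  simpa [optTuples] using hd

theorem exists_isSetD_optTuples {A : Type} (o : Option (DD A)) :
    ∃ d : DD A, IsSetD d ∧ ∀ v, dmem v d ↔ v ∈ optTuples o := by
  cases o with
  | none =>
    have hr : (PD.set Empty Empty.elim Empty.elim : PD A).FiniteRank := ⟨1, fun i => i.elim⟩
    refine ⟨toD _ hr, ⟨_, _, _, hr, rfl⟩, fun v => ⟨?_, ?_⟩⟩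
    · rintro ⟨ι, hd, tl, hfr, he, i, -⟩
      obtain ⟨m, hm⟩ := PD.equiv_of_toD_eq he
      cases m with
      | zero => exact hm.elim
      | succ m => exact (hm.2 i).choose.elim
    · rintro ⟨d, hd, -⟩
      cases hd
  | some d =>
    obtain ⟨⟨x, hx⟩, rfl⟩ := Quot.exists_rep d
    have hr : (PD.set Unit (fun _ => x) (fun _ => [])).FiniteRank :=
      hx.elim fun n hn => ⟨n + 1, fun _ => ⟨hn, by simp⟩⟩
    refine ⟨toD _ hr, ⟨_, _, _, hr, rfl⟩, fun v => ⟨?_, ?_⟩⟩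
    · obtain ⟨v, l⟩ := v
      rintro ⟨ι, hd, tl, hfr, he, i, ⟨hi, rfl⟩, hl⟩
      obtain ⟨m, hm⟩ := PD.equiv_of_toD_eq he
      cases m with
      | zero => exact hm.elim
      | succ m =>
        obtain ⟨_, hj, hj'⟩ := hm.2 i
        rw [List.forall₂_nil_left_iff.1 hj', List.forall₂_nil_left_iff] at hl
        simp only at hl
        subst hl
        exact ⟨_, rfl, Prod.ext (Quot.sound ⟨m, hj.symm⟩) rfl⟩
    · rintro ⟨_, ⟨⟩, rfl⟩
      exact ⟨_, _, _, hr, rfl, (), ⟨hx, rfl⟩, .nil⟩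

theorem exists_mkSet?_optTuples {A : Type} (o : Option (DD A)) :
    ∃ d, mkSet? (optTuples o) = some d ∧ ∀ v, dmem v d ↔ v ∈ optTuples o :=
  have h := exists_isSetD_optTuples o
  ⟨h.choose, dif_pos h, h.choose_spec.2⟩

theorem mkSet?_optTuples_injective {A : Type} :
    Function.Injective fun o : Option (DD A) => mkSet? (optTuples o) := by
  intro o o' h
  obtain ⟨d, hd, hv⟩ := exists_mkSet?_optTuples o
  obtain ⟨d', hd', hv'⟩ := exists_mkSet?_optTuples o'
  have hdd : d = d' := Option.some.inj (hd.symm.trans (h.trans hd'))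
  subst hdd
  exact optTuples_injective (Set.ext fun v => (hv v).symm.trans (hv' v))

/-- The intensional set `{x : x : x = τ}`. -/
def probe {S : Sig.{v}} (τ : GTerm S) : GTerm S :=
  .iset 1 0 (fun c _ => .dom (c 0)) fun c => .eq (.dom (c 0)) τ

theorem extw_probe {S : Sig.{v}} {I : Interp S} {w : W} (hI : AssignValid (I.s w)) (τ : GTerm S) :
    extw I w 1 0 (fun c _ => .dom (c 0)) (fun c => .eq (.dom (c 0)) τ) =
      mkSet? (optTuples (I.s w τ)) := by
  rw [extw, if_neg]
  · congr 1
    ext v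
    simp only [SatS, hI.1, optTuples, Set.mem_ofPred_eq, Option.some.injEq]
    constructor
    · rintro ⟨c, ds, ⟨d, rfl, hd⟩, hc, rfl⟩
      exact ⟨c 0, hd, by simp [famToTup, ← hc 0]⟩
    · rintro ⟨d, hd, rfl⟩
      exact ⟨fun _ => d, fun _ => d, ⟨d, rfl, hd⟩, fun _ => rfl, by simp [famToTup]⟩
  · rintro ⟨c, -, i, hi⟩
    simp [hI.1] at hi

theorem cval_there_probe {S : Sig.{v}} {I : Interp S} (hI : I.Valid) (τ : GTerm S) :
    cval I .t (probe τ) = mkSet? (optTuples (I.st τ)) := by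
  rw [probe, cval]
  exact extw_probe (w := .t) hI.2.1 τ

theorem cval_here_probe {S : Sig.{v}} {I : Interp S} (hI : I.Valid) (τ : GTerm S) :
    cval I .h (probe τ) = if I.sh τ = I.st τ then mkSet? (optTuples (I.sh τ)) else none := by
  simp only [probe, cval, extw_probe (w := .h) hI.1, extw_probe (w := .t) hI.2.1]
  exact if_congr mkSet?_optTuples_injective.eq_iff rfl rfl

/-- For any pair of interpretations: `I₁ = I₂` iff
`C(I₁) = C(I₂)`. -/
theorem eq_iff_cohClosure_eq {S : Sig.{v}} (I1 I2 : Interp S)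
    (h1 : I1.Valid) (h2 : I2.Valid) :
    I1 = I2 ↔ CohC I1 = CohC I2 := by
  refine ⟨congrArg CohC, fun h => ?_⟩
  have hst : I1.st = I2.st := by
    funext τ
    apply mkSet?_optTuples_injective
    have hτ : cval I1 .t (probe τ) = cval I2 .t (probe τ) :=
      congrFun (congrArg Interp.st h) (probe τ)
    rwa [cval_there_probe h1, cval_there_probe h2] at hτ
  have hsh : I1.sh = I2.sh := by
    funext τ
    have hτ : cval I1 .h (probe τ) = cval I2 .h (probe τ) :=
      congrFun (congrArg Interp.sh h) (probe τ)
    rw [cval_here_probe h1, cval_here_probe h2, hst] at hτ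
    obtain ⟨d₁, hd₁, -⟩ := exists_mkSet?_optTuples (I1.sh τ)
    obtain ⟨d₂, hd₂, -⟩ := exists_mkSet?_optTuples (I2.sh τ)
    have hle₁ := h1.2.2.1 τ
    have hle₂ := h2.2.2.1 τ
    rw [hst] at hle₁
    split_ifs at hτ <;> simp_all
  cases I1
  cases I2
  cases hst
  cases hsh
  cases congrArg Interp.Ih h
  cases congrArg Interp.It h
  rfl

end
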